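/- Let a be a positive real number and let D = {z ∈ ℂ : -a < Re(z) < a and -a < Im(z) < a}. Let p : ℂ → ℂ be a function that is holomorphic and injective on some open set containing the closure of D. Suppose there exists a semialgebraic set T ⊆ ℂ⁴ (under the identification of ℂ⁴ with ℝ⁸ via real and imaginary parts) such that for all w, x, y, z ∈ D one has w = x·y + z if and only if (p(w), p(x), p(y), p(z)) ∈ T. Then p is algebraic on D: there exists a nonzero polynomial f ∈ ℂ[z₁, z₂] such that f(z, p(z)) = 0 for every z ∈ D. -/

import Mathlib

open Complex

/-- A set `S ⊆ ℝⁿ` is semialgebraic if it is a finite union of sets of the form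
`{x : p(x) = 0 ∧ q₁(x) > 0 ∧ ⋯ ∧ q_m(x) > 0}` for real polynomials `p, q₁, …, q_m`. -/
def IsSemialgebraic {n : ℕ} (S : Set (Fin n → ℝ)) : Prop :=
  ∃ (k : ℕ) (p : Fin k → MvPolynomial (Fin n) ℝ) (m : Fin k → ℕ)
    (q : (i : Fin k) → Fin (m i) → MvPolynomial (Fin n) ℝ),
    S = ⋃ i : Fin k,
      {x | MvPolynomial.eval x (p i) = 0 ∧ ∀ j, 0 < MvPolynomial.eval x (q i j)}

/-- The identification `ℂ⁴ ≅ ℝ⁸`, sending each complex coordinate to its real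
and imaginary parts. -/
def complexFourToRealEight (v : Fin 4 → ℂ) : Fin 8 → ℝ := fun i =>
  if h : (i : ℕ) < 4 then (v ⟨(i : ℕ), h⟩).re
  else (v ⟨(i : ℕ) - 4, by have := i.isLt; omega⟩).im

/-- The open square `D = {z : -a < Re z < a, -a < Im z < a}`. -/
def squareDomain (a : ℝ) : Set ℂ :=
  {z | -a < z.re ∧ z.re < a ∧ -a < z.im ∧ z.im < a}

open MvPolynomial Filter Topology ComplexConjugate

namespace MvPolynomial

theorem hasDerivAt_eval_comp {𝕜 σ : Type*} [NontriviallyNormedField 𝕜] [Fintype σ]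
    (A : MvPolynomial σ 𝕜) {c : 𝕜 → σ → 𝕜} {c' : σ → 𝕜} {t : 𝕜}
    (hc : ∀ i, HasDerivAt (fun s => c s i) (c' i) t) :
    HasDerivAt (fun s => eval (c s) A) (∑ i, eval (c t) (pderiv i A) * c' i) t := by
  classical
  induction A using MvPolynomial.induction_on with
  | C a => simpa using hasDerivAt_const t a
  | add p q hp hq =>
    have h := hp.add hq
    simp only [map_add, add_mul, Finset.sum_add_distrib]
    exact h
  | mul_X p i hp =>
    have h := hp.mul (hc i)
    simp only [map_mul, eval_X, Derivation.leibniz, smul_eq_mul, map_add, pderiv_X, Pi.single_apply]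
    refine h.congr_deriv ?_
    simp only [add_mul, Finset.sum_add_distrib, Finset.sum_mul]
    rw [add_comm]
    congr 1
    · rw [Finset.sum_eq_single i]
      · simp
      · intro j _ hj
        simp [hj.symm]
      · simp
    · exact Finset.sum_congr rfl fun j _ => by ring

theorem totalDegree_pderiv_lt {R σ : Type*} [CommSemiring R] {A : MvPolynomial σ R} {i : σ}
    (h : pderiv i A ≠ 0) : (pderiv i A).totalDegree < A.totalDegree := by
  classical
  have key : ∀ d ∈ (pderiv i A).support, (d.sum fun _ e => e) < A.totalDegree := by
    intro d hd
    rw [A.as_sum, map_sum] at hd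
    obtain ⟨m, hm, hdm⟩ := Finset.mem_biUnion.1 (support_sum hd)
    rw [pderiv_monomial] at hdm
    have hd' : d = m - Finsupp.single i 1 := by
      simpa using support_monomial_subset hdm
    have hmi : m i ≠ 0 := by
      intro h0
      simp [h0] at hdm
    have hle : Finsupp.single i 1 ≤ m := by
      simpa [Finsupp.single_le_iff] using Nat.one_le_iff_ne_zero.2 hmi
    have hm' : m = d + Finsupp.single i 1 := by
      rw [hd', tsub_add_cancel_of_le hle]
    have := le_totalDegree hm
    rw [hm', Finsupp.sum_add_index' (by simp) (by simp), Finsupp.sum_single_index rfl] at this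
    omega
  obtain ⟨d, hd⟩ := Finset.nonempty_iff_ne_empty.2 (mt support_eq_empty.1 h)
  exact (Finset.sup_lt_iff ((Nat.zero_le _).trans_lt (key d hd))).2 key

theorem eval_map_eval_sumAlgEquiv {R σ τ : Type*} [CommSemiring R] (Q : MvPolynomial (σ ⊕ τ) R)
    (s : σ → R) (t : τ → R) :
    eval s (map (eval t) (sumAlgEquiv R σ τ Q)) = eval (Sum.elim s t) Q := by
  induction Q using MvPolynomial.induction_on with
  | C a => simp
  | add p q hp hq => rw [map_add, map_add, map_add, map_add, hp, hq]
  | mul_X p i hp =>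
    rw [map_mul, map_mul, map_mul, map_mul, hp]
    cases i <;> simp

end MvPolynomial

/-- If `w, Y` are algebraically dependent and `y ∈ K(w, Y)`, then so are `y, Y`. -/
theorem not_algebraicIndependent_of_mem_adjoin_pair {K M : Type*} [Field K] [Field M] [Algebra K M]
    {w Y y : M} (hw : ¬ AlgebraicIndependent K ![w, Y])
    (hy : y ∈ IntermediateField.adjoin K {w, Y}) : ¬ AlgebraicIndependent K ![y, Y] := by
  intro hind
  set L := IntermediateField.adjoin K {w, Y} with hL
  have hwL : w ∈ L := IntermediateField.subset_adjoin _ _ (by simp)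
  have hYL : Y ∈ L := IntermediateField.subset_adjoin _ _ (by simp)
  have h1 : AlgebraicIndependent K (![⟨y, hy⟩, ⟨Y, hYL⟩] : Fin 2 → L) := by
    refine AlgebraicIndependent.of_comp L.val ?_
    convert hind using 1
    ext i; fin_cases i <;> rfl
  let v : Fin 2 → L := ![⟨w, hwL⟩, ⟨Y, hYL⟩]
  have hv : L.val ∘ v = ![w, Y] := by ext i; fin_cases i <;> rfl
  have htop : IntermediateField.adjoin K (Set.range v) = ⊤ := by
    apply IntermediateField.lift_injective
    rw [IntermediateField.lift_adjoin, IntermediateField.lift_top, ← Set.range_comp]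
    change IntermediateField.adjoin K (Set.range (L.val ∘ v)) = L
    rw [hv, hL, Matrix.range_cons, Matrix.range_cons, Matrix.range_empty, Set.union_empty,
      Set.singleton_union]
  have : Algebra.IsAlgebraic (Algebra.adjoin K (Set.range v)) L := by
    rw [← IntermediateField.isAlgebraic_adjoin_iff_top, htop, Algebra.isAlgebraic_iff_isIntegral]
    infer_instance
  have h2 := Algebra.IsAlgebraic.isTranscendenceBasis_of_lift_le_trdeg_of_finite K v
    (by simpa using h1.lift_cardinalMk_le_trdeg)
  apply hw
  rw [← hv]
  exact h2.1.map' L.val.injective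

/-- Polarisation: a polynomial relation between holomorphic functions and their conjugates that
holds on the diagonal of `U × U` holds on all of `U × U`. -/
theorem eval_conj_eq_zero_of_diagonal {E ι : Type*} [NormedAddCommGroup E] [NormedSpace ℂ E]
    {U : Set E} (hUo : IsOpen U) (hUc : Convex ℝ U) {S : E → ι → ℂ}
    (hS : ∀ i, DifferentiableOn ℂ (fun u => S u i) U) (Q : MvPolynomial (ι ⊕ ι) ℂ)
    (hQ : ∀ u ∈ U, eval (Sum.elim (S u) fun i => conj (S u i)) Q = 0)
    {u v : E} (hu : u ∈ U) (hv : v ∈ U) :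
    eval (Sum.elim (S u) fun i => conj (S v i)) Q = 0 := by
  let c : ℂ → E := fun t => (1 / 2 : ℂ) • (u + v) + (t / (2 * I)) • (u - v)
  have hc : Differentiable ℂ c := by fun_prop
  have hcI : c I = u := by
    have : (I / (2 * I) : ℂ) = 1 / 2 := by field_simp
    simp only [c, this]; module
  have hcI' : c (-I) = v := by
    have : (-I / (2 * I) : ℂ) = -(1 / 2) := by field_simp
    simp only [c, this]; module
  have hconvex : Convex ℝ (c ⁻¹' U) := by
    intro s hs t ht α β hα hβ hαβ
    have : c (α • s + β • t) = α • c s + β • c t := by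
      have h2 : (β : ℂ) = 1 - α := by
        rw [eq_sub_iff_add_eq', ← Complex.ofReal_add, hαβ, Complex.ofReal_one]
      rw [← Complex.coe_smul, ← Complex.coe_smul, ← Complex.coe_smul (x := α) (y := c s),
        ← Complex.coe_smul (x := β) (y := c t), h2]
      simp only [c, smul_eq_mul]
      module
    rw [Set.mem_preimage, this]
    exact hUc hs ht hα hβ hαβ
  let Λ : Set ℂ := c ⁻¹' U ∩ conj ⁻¹' (c ⁻¹' U)
  have hΛo : IsOpen Λ :=
    (hUo.preimage hc.continuous).inter ((hUo.preimage hc.continuous).preimage continuous_conj)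
  have hΛc : Convex ℝ Λ := hconvex.inter (hconvex.linear_preimage Complex.conjAe.toLinearMap)
  have hI : I ∈ Λ := ⟨by simpa [hcI] using hu, by simpa [hcI'] using hv⟩
  have hnI : -I ∈ Λ := ⟨by simpa [hcI'] using hv, by simpa [hcI] using hu⟩
  have h0 : (0 : ℂ) ∈ Λ := by
    have := hΛc hI hnI (a := 1 / 2) (b := 1 / 2) (by norm_num) (by norm_num) (by norm_num)
    simpa using this
  let H : ℂ → ℂ := fun t => aeval (Sum.elim (S (c t)) fun i => conj (S (c (conj t)) i)) Q
  have hH : AnalyticOnNhd ℂ H Λ := by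
    refine AnalyticOnNhd.aeval_mvPolynomial ?_ Q
    rintro (i | i)
    · refine DifferentiableOn.analyticOnNhd ?_ hΛo
      exact (hS i).comp hc.differentiableOn fun t ht => ht.1
    · refine DifferentiableOn.analyticOnNhd ?_ hΛo
      intro t ht
      have h1 : DifferentiableAt ℂ (fun s => S (c s) i) (conj t) :=
        ((hS i).differentiableAt (hUo.mem_nhds ht.2)).comp _ (hc _)
      have h2 := h1.star_conj
      rw [Complex.conj_conj] at h2
      exact h2.differentiableWithinAt
  have hreal : ∃ᶠ t in 𝓝[≠] (0 : ℂ), H t = 0 := by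
    have h1 : Tendsto (fun s : ℝ => (s : ℂ)) (𝓝[≠] 0) (𝓝[≠] 0) := by
      refine tendsto_nhdsWithin_iff.2 ⟨?_, ?_⟩
      · exact (Complex.continuous_ofReal.tendsto' 0 0 (by simp)).mono_left nhdsWithin_le_nhds
      · filter_upwards [self_mem_nhdsWithin] with s hs
        simpa using hs
    refine h1.frequently (Eventually.frequently ?_)
    have h2 : ∀ᶠ s : ℝ in 𝓝[≠] 0, (s : ℂ) ∈ Λ :=
      h1.eventually (mem_nhdsWithin_of_mem_nhds (hΛo.mem_nhds h0))
    filter_upwards [h2] with s hs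
    simpa [H] using hQ _ hs.1
  have := hH.eqOn_zero_of_preconnected_of_frequently_eq_zero hΛc.isPreconnected h0 hreal hI
  simpa [H, hcI, hcI'] using this

/-- A nonzero polynomial relation between `S u` and the conjugate of `S v`, valid for all `u` and `v`,
gives a nonzero polynomial relation among the coordinates of `S`. -/
theorem exists_ne_zero_eval_eq_zero_of_eval_conj_eq_zero {E ι : Type*}
    {U : Set E} {S : E → ι → ℂ} {Q : MvPolynomial (ι ⊕ ι) ℂ} (hQ0 : Q ≠ 0)
    (hQ : ∀ u ∈ U, ∀ v ∈ U, eval (Sum.elim (S u) fun i => conj (S v i)) Q = 0) :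
    ∃ A : MvPolynomial ι ℂ, A ≠ 0 ∧ ∀ u ∈ U, eval (S u) A = 0 := by
  let B := sumAlgEquiv ℂ ι ι Q
  have hB0 : B ≠ 0 := by simpa [B] using hQ0
  by_cases h : ∃ v ∈ U, map (eval fun i => conj (S v i)) B ≠ 0
  · obtain ⟨v, hv, hne⟩ := h
    exact ⟨_, hne, fun u hu => by
      rw [eval_map_eval_sumAlgEquiv, hQ u hu v hv]⟩
  · push Not at h
    obtain ⟨d, hd⟩ := ne_zero_iff.1 hB0
    refine ⟨map (starRingEnd ℂ) (coeff d B), ?_, fun u hu => ?_⟩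
    · rwa [Ne, map_eq_zero_iff _ (map_injective _ (RingHom.injective _))]
    · have h1 : eval (fun i => conj (S u i)) (coeff d B) = 0 := by
        rw [← coeff_map, h u hu, coeff_zero]
      have h2 := congrArg (starRingEnd ℂ) h1
      rw [map_zero] at h2
      rw [← h2, eval_map, ← coe_eval₂Hom, ← RingHom.comp_apply]
      congr 1
      ext <;> simp

/-- The points of a semialgebraic set that are not interior lie on a hypersurface. -/
theorem IsSemialgebraic.exists_eval_eq_zero_of_notMem_interior {n : ℕ} {S : Set (Fin n → ℝ)}
    (hS : IsSemialgebraic S) :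
    ∃ P : MvPolynomial (Fin n) ℝ, P ≠ 0 ∧ ∀ x ∈ S, x ∉ interior S → eval x P = 0 := by
  classical
  obtain ⟨k, p, m, q, rfl⟩ := hS
  refine ⟨∏ i, if p i = 0 then 1 else p i, ?_, fun x hx hmem_int => ?_⟩
  · refine Finset.prod_ne_zero_iff.2 fun i _ => ?_
    split_ifs with h
    · exact one_ne_zero
    · exact h
  · obtain ⟨i, hpi, hqi⟩ := Set.mem_iUnion.1 hx
    rw [map_prod]
    refine Finset.prod_eq_zero (Finset.mem_univ i) ?_
    split_ifs with h
    · refine absurd (mem_interior.2 ⟨⋂ j, {x | 0 < eval x (q i j)}, ?_, ?_, ?_⟩) hmem_int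
      · refine fun y hy => Set.mem_iUnion.2 ⟨i, by simp [h], fun j => Set.mem_iInter.1 hy j⟩
      · exact isOpen_iInter_of_finite fun j =>
          isOpen_lt continuous_const (MvPolynomial.continuous_eval _)
      · exact Set.mem_iInter.2 hqi
    · exact hpi

theorem complexFourToRealEight_bijective : Function.Bijective complexFourToRealEight := by
  refine ⟨fun s t h => ?_, fun r => ?_⟩
  · ext i
    have h1 := congrFun h ⟨i, by omega⟩
    have h2 := congrFun h ⟨i + 4, by omega⟩
    simp only [complexFourToRealEight, i.isLt, dif_pos, Fin.eta] at h1
    simp [complexFourToRealEight] at h2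
    exact Complex.ext h1 h2
  · refine ⟨fun i => ⟨r ⟨i, by omega⟩, r ⟨i + 4, by omega⟩⟩, ?_⟩
    ext i
    by_cases h : (i : ℕ) < 4
    · simp [complexFourToRealEight, h]
    · have : (i : ℕ) - 4 + 4 = i := by omega
      simp [complexFourToRealEight, h, this]

theorem continuous_complexFourToRealEight : Continuous complexFourToRealEight := by
  refine continuous_pi fun i => ?_
  unfold complexFourToRealEight
  split_ifs <;> fun_prop

/-- A nonzero real polynomial on `ℝ⁸` is a nonzero complex polynomial in the coordinates of `ℂ⁴` and
their conjugates. -/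
theorem exists_complexification {P : MvPolynomial (Fin 8) ℝ} (hP : P ≠ 0) :
    ∃ Q : MvPolynomial (Fin 4 ⊕ Fin 4) ℂ, Q ≠ 0 ∧ ∀ s : Fin 4 → ℂ,
      eval (Sum.elim s fun i => conj (s i)) Q = (eval (complexFourToRealEight s) P : ℝ) := by
  let Q : MvPolynomial (Fin 4 ⊕ Fin 4) ℂ := aeval (fun i : Fin 8 =>
    if h : (i : ℕ) < 4 then
      C (1 / 2) * (X (.inl ⟨i, h⟩) + X (.inr ⟨i, h⟩))
    else
      C (1 / (2 * I)) * (X (.inl ⟨(i : ℕ) - 4, by have := i.isLt; omega⟩) -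
        X (.inr ⟨(i : ℕ) - 4, by have := i.isLt; omega⟩))) P
  have hQ : ∀ s : Fin 4 → ℂ,
      eval (Sum.elim s fun i => conj (s i)) Q = (eval (complexFourToRealEight s) P : ℝ) := by
    intro s
    have re_eq : ∀ z : ℂ, 1 / 2 * (z + conj z) = (z.re : ℂ) := fun z => by
      rw [Complex.add_conj]; push_cast; ring
    have im_eq : ∀ z : ℂ, 1 / (2 * I) * (z - conj z) = (z.im : ℂ) := fun z => by
      rw [Complex.sub_conj]; push_cast; field_simp
    simp only [Q]
    clear hP Q
    induction P using MvPolynomial.induction_on with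
    | C a => simp [algebraMap_eq, IsScalarTower.algebraMap_apply ℝ ℂ (MvPolynomial _ ℂ)]
    | add p q hp hq => rw [map_add, map_add, map_add, hp, hq, Complex.ofReal_add]
    | mul_X p i hp =>
      rw [map_mul, map_mul, map_mul, hp, Complex.ofReal_mul, aeval_X, eval_X]
      congr 1
      unfold complexFourToRealEight
      split_ifs with h
      · simpa using re_eq (s ⟨i, h⟩)
      · simpa using im_eq (s ⟨(i : ℕ) - 4, by have := i.isLt; omega⟩)
  refine ⟨Q, fun h => hP (MvPolynomial.funext fun r => ?_), hQ⟩
  obtain ⟨s, rfl⟩ := complexFourToRealEight_bijective.2 r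
  have := hQ s
  rw [h, map_zero, eq_comm, Complex.ofReal_eq_zero] at this
  simpa using this

theorem exists_mem_pderiv_notMem {R σ : Type*} [CommSemiring R] {𝒥 : Set (MvPolynomial σ R)} {i : σ}
    (h𝒥 : ∀ B ∈ 𝒥, pderiv i B = 0 → B = 0) {A : MvPolynomial σ R} (hA : A ∈ 𝒥) (hA0 : A ≠ 0) :
    ∃ B ∈ 𝒥, pderiv i B ∉ 𝒥 := by
  by_cases h : pderiv i A ∈ 𝒥
  · exact exists_mem_pderiv_notMem h𝒥 h (mt (h𝒥 A hA) hA0)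
  · exact ⟨A, hA, h⟩
termination_by A.totalDegree
decreasing_by exact totalDegree_pderiv_lt (mt (h𝒥 A hA) hA0)

/-- If `W` and `Y` are algebraically dependent near `y₀` and the variable `y` is a rational function of
`W` and `Y`, then `Y` is algebraic near `y₀`. -/
theorem exists_eventually_eval_eq_zero {W Y : ℂ → ℂ} {y₀ : ℂ}
    (hY : AnalyticAt ℂ Y y₀) {c a b : MvPolynomial (Fin 2) ℂ} (hc0 : c ≠ 0)
    (hc : ∀ᶠ y in 𝓝 y₀, eval ![W y, Y y] c = 0)
    (hab : ∀ᶠ y in 𝓝 y₀, y * eval ![W y, Y y] b = eval ![W y, Y y] a)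
    (hb : ∀ᶠ y in 𝓝 y₀, eval ![W y, Y y] b ≠ 0) :
    ∃ f : MvPolynomial (Fin 2) ℂ, f ≠ 0 ∧ ∀ᶠ y in 𝓝 y₀, eval ![y, Y y] f = 0 := by
  let φ : Ultrafilter ℂ := Ultrafilter.of (𝓝[≠] y₀)
  have hφ : (φ : Filter ℂ) ≤ 𝓝[≠] y₀ := Ultrafilter.of_le _
  have hφ' : (φ : Filter ℂ) ≤ 𝓝 y₀ := hφ.trans nhdsWithin_le_nhds
  let q : (ℂ → ℂ) →+* Germ (φ : Filter ℂ) ℂ := Germ.coeRingHom _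
  let _ : Algebra ℂ (Germ (φ : Filter ℂ) ℂ) := (q.comp (algebraMap ℂ (ℂ → ℂ))).toAlgebra
  have hq : ∀ (g h : ℂ → ℂ) (B : MvPolynomial (Fin 2) ℂ),
      aeval ![q g, q h] B = q fun y => eval ![g y, h y] B := by
    intro g h B
    induction B using MvPolynomial.induction_on with
    | C a => simp; rfl
    | add p r hp hr =>
      rw [map_add, hp, hr, ← map_add]
      congr 1; ext y; simp
    | mul_X p i hp =>
      rw [map_mul, hp, aeval_X]
      have : ![q g, q h] i = q fun y => ![g y, h y] i := by fin_cases i <;> rfl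
      rw [this, ← map_mul]
      congr 1; ext y; simp
  have q_eq : ∀ g h : ℂ → ℂ, q g = q h ↔ ∀ᶠ y in φ, g y = h y := fun g h => Germ.coe_eq
  have hw : ¬ AlgebraicIndependent ℂ ![q W, q Y] := by
    intro hind
    refine hc0 (hind.eq_zero_of_aeval_eq_zero c ?_)
    rw [hq, ← map_zero q, q_eq]
    exact hφ' hc
  have hmem : ∀ B : MvPolynomial (Fin 2) ℂ,
      aeval ![q W, q Y] B ∈ IntermediateField.adjoin ℂ {q W, q Y} := by
    intro B
    apply IntermediateField.algebra_adjoin_le_adjoin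
    have := Algebra.adjoin_range_eq_range_aeval ℂ ![q W, q Y]
    rw [Matrix.range_cons, Matrix.range_cons, Matrix.range_empty, Set.union_empty,
      Set.singleton_union] at this
    rw [this]
    exact ⟨B, rfl⟩
  have hb' : aeval ![q W, q Y] b ≠ 0 := by
    rw [hq, ← map_zero q, Ne, q_eq]
    intro h
    obtain ⟨y, h1, h2⟩ := (h.and (hφ' hb)).exists
    exact h2 h1
  have hy : q id ∈ IntermediateField.adjoin ℂ {q W, q Y} := by
    have : q id = aeval ![q W, q Y] a / aeval ![q W, q Y] b := by
      rw [eq_div_iff hb', hq, hq, ← map_mul, q_eq]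
      exact hφ' hab
    rw [this]
    exact div_mem (hmem a) (hmem b)
  have hdep := not_algebraicIndependent_of_mem_adjoin_pair hw hy
  rw [algebraicIndependent_iff] at hdep
  push Not at hdep
  obtain ⟨f, hf, hf0⟩ := hdep
  refine ⟨f, hf0, ?_⟩
  rw [hq, ← map_zero q, q_eq] at hf
  have han : AnalyticAt ℂ (fun y => eval ![y, Y y] f) y₀ := by
    refine AnalyticAt.aeval_mvPolynomial (f := fun y => ![y, Y y]) (fun i => ?_) f
    fin_cases i
    · exact analyticAt_id
    · exact hY
  exact han.frequently_zero_iff_eventually_zero.1 (hf.frequently.filter_mono hφ)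

theorem isOpen_squareDomain (a : ℝ) : IsOpen (squareDomain a) := by
  have : squareDomain a = Complex.re ⁻¹' Set.Ioo (-a) a ∩ Complex.im ⁻¹' Set.Ioo (-a) a := by
    ext z; simp [squareDomain, and_assoc]
  rw [this]
  exact (isOpen_Ioo.preimage Complex.continuous_re).inter
    (isOpen_Ioo.preimage Complex.continuous_im)

theorem convex_squareDomain (a : ℝ) : Convex ℝ (squareDomain a) := by
  have : squareDomain a = Complex.re ⁻¹' Set.Ioo (-a) a ∩ Complex.im ⁻¹' Set.Ioo (-a) a := by
    ext z; simp [squareDomain, and_assoc]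
  rw [this]
  exact ((convex_Ioo _ _).linear_preimage Complex.reLm).inter
    ((convex_Ioo _ _).linear_preimage Complex.imLm)

theorem mem_squareDomain_of_norm_lt {a : ℝ} {z : ℂ} (hz : ‖z‖ < a) : z ∈ squareDomain a := by
  have h1 := abs_lt.1 ((Complex.abs_re_le_norm z).trans_lt hz)
  have h2 := abs_lt.1 ((Complex.abs_im_le_norm z).trans_lt hz)
  exact ⟨h1.1, h1.2, h2.1, h2.2⟩

/-- The values of `p` at `x * y + z`, `x`, `y`, `z`. -/
def relationPoint (p : ℂ → ℂ) (u : Fin 3 → ℂ) : Fin 4 → ℂ :=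
  ![p (u 0 * u 1 + u 2), p (u 0), p (u 1), p (u 2)]

theorem relationPoint_vec (p : ℂ → ℂ) (x y z : ℂ) :
    relationPoint p ![x, y, z] = ![p (x * y + z), p x, p y, p z] := rfl

/-- If `p` carries the relation `w = x * y + z` to a semialgebraic one, then `p (x * y + z)`, `p x`,
`p y`, `p z` satisfy a nonzero polynomial relation. -/
theorem exists_eval_relationPoint_eq_zero {D : Set ℂ} (hD : IsOpen D) {p : ℂ → ℂ}
    (hp : DifferentiableOn ℂ p D) {T : Set (Fin 4 → ℂ)}
    (hT : IsSemialgebraic (complexFourToRealEight '' T))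
    (hTp : ∀ w x y z : ℂ, w ∈ D → x ∈ D → y ∈ D → z ∈ D →
      (w = x * y + z ↔ ![p w, p x, p y, p z] ∈ T))
    {U : Set (Fin 3 → ℂ)} (hUo : IsOpen U) (hUc : Convex ℝ U)
    (hUD : ∀ u ∈ U, u 0 * u 1 + u 2 ∈ D ∧ ∀ i, u i ∈ D) :
    ∃ A : MvPolynomial (Fin 4) ℂ, A ≠ 0 ∧ ∀ u ∈ U, eval (relationPoint p u) A = 0 := by
  obtain ⟨P, hP0, hP⟩ := hT.exists_eval_eq_zero_of_notMem_interior
  obtain ⟨Q, hQ0, hQ⟩ := exists_complexification hP0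
  have hS : ∀ i, DifferentiableOn ℂ (fun u => relationPoint p u i) U := by
    intro i
    fin_cases i
    · exact hp.comp (by fun_prop) fun u hu => (hUD u hu).1
    · exact hp.comp (by fun_prop) fun u hu => (hUD u hu).2 0
    · exact hp.comp (by fun_prop) fun u hu => (hUD u hu).2 1
    · exact hp.comp (by fun_prop) fun u hu => (hUD u hu).2 2
  refine exists_ne_zero_eval_eq_zero_of_eval_conj_eq_zero hQ0 fun u hu v hv =>
    eval_conj_eq_zero_of_diagonal hUo hUc hS Q (fun u hu => ?_) hu hv
  obtain ⟨hw, hx⟩ := hUD u hu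
  have hmem : relationPoint p u ∈ T := (hTp _ _ _ _ hw (hx 0) (hx 1) (hx 2)).1 rfl
  rw [hQ, hP _ ⟨_, hmem, rfl⟩, Complex.ofReal_zero]
  intro hmem_int
  have hcont : ContinuousAt
      (fun w => complexFourToRealEight ![p w, p (u 0), p (u 1), p (u 2)]) (u 0 * u 1 + u 2) := by
    refine continuous_complexFourToRealEight.continuousAt.comp (continuousAt_pi.2 fun i => ?_)
    have := (hp.differentiableAt (hD.mem_nhds hw)).continuousAt
    fin_cases i
    · exact this
    all_goals exact continuousAt_const
  have hev : ∀ᶠ w in 𝓝 (u 0 * u 1 + u 2), w = u 0 * u 1 + u 2 := by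
    filter_upwards [hcont.eventually (isOpen_interior.mem_nhds hmem_int), hD.mem_nhds hw] with w h1 h2
    obtain ⟨t, ht, hte⟩ := interior_subset h1
    rw [hTp _ _ _ _ h2 (hx 0) (hx 1) (hx 2), ← complexFourToRealEight_bijective.1 hte]
    exact ht
  obtain ⟨w, h1, h2⟩ :=
    ((eventually_nhdsWithin_of_eventually_nhds hev).and
      (self_mem_nhdsWithin (a := u 0 * u 1 + u 2) (s := {u 0 * u 1 + u 2}ᶜ))).exists
  exact h2 h1

theorem eq_zero_of_eval_relationPoint_eq_zero {p : ℂ → ℂ} {r : ℝ} (hr : 0 < r)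
    (hinj : Set.InjOn p (Metric.ball 0 r)) {B : MvPolynomial (Fin 4) ℂ}
    (hB : ∀ u ∈ Metric.ball (0 : Fin 3 → ℂ) r, eval (relationPoint p u) B = 0)
    (hB' : pderiv 0 B = 0) : B = 0 := by
  have hinf : (p '' Metric.ball 0 r).Infinite :=
    (infinite_of_mem_nhds 0 (Metric.ball_mem_nhds 0 hr)).image hinj
  refine MvPolynomial.funext_set
    (![Set.univ, p '' Metric.ball 0 r, p '' Metric.ball 0 r, p '' Metric.ball 0 r]) ?_ ?_
  · intro i
    fin_cases i
    · exact Set.infinite_univ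
    all_goals exact hinf
  · intro s hs
    obtain ⟨x, hx, hxs⟩ : s 1 ∈ p '' Metric.ball 0 r := hs 1 trivial
    obtain ⟨y, hy, hys⟩ : s 2 ∈ p '' Metric.ball 0 r := hs 2 trivial
    obtain ⟨z, hz, hzs⟩ : s 3 ∈ p '' Metric.ball 0 r := hs 3 trivial
    have hder : ∀ t, HasDerivAt (fun t : ℂ => eval ![t, p x, p y, p z] B) 0 t := by
      intro t
      have h := hasDerivAt_eval_comp B (c := fun t => ![t, p x, p y, p z]) (c' := ![1, 0, 0, 0])
        (t := t) (by
          intro i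
          fin_cases i
          · exact hasDerivAt_id t
          all_goals exact hasDerivAt_const t _)
      simpa [Fin.sum_univ_four, hB'] using h
    have hconst := is_const_of_deriv_eq_zero (fun t => (hder t).differentiableAt)
      (fun t => (hder t).deriv) (s 0) (p (x * y + z))
    have hs' : s = ![s 0, p x, p y, p z] := by
      ext i; fin_cases i <;> simp [hxs, hys, hzs]
    rw [hs', map_zero]
    refine hconst.trans (hB ![x, y, z] ?_)
    rw [mem_ball_zero_iff] at *
    refine (pi_norm_lt_iff hr).2 fun i => ?_
    fin_cases i
    · exact hx
    · exact hy
    · exact hz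

/-- An injective holomorphic function has nonzero derivative at points arbitrarily near any given
point. -/
theorem frequently_deriv_ne_zero_of_injOn {D : Set ℂ} (hD : IsOpen D) {p : ℂ → ℂ}
    (hp : DifferentiableOn ℂ p D) (hinj : Set.InjOn p D) {w : ℂ} (hw : w ∈ D) :
    ∃ᶠ t in 𝓝 w, deriv p t ≠ 0 := by
  intro h
  simp only [not_not] at h
  obtain ⟨ε, hε, hball⟩ := Metric.eventually_nhds_iff_ball.1 (h.and (hD.mem_nhds hw))
  have hconst : ∀ t ∈ Metric.ball w ε, p t = p w := fun t ht =>
    Metric.isOpen_ball.is_const_of_deriv_eq_zero (convex_ball w ε).isPreconnected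
      (hp.mono fun t ht => (hball t ht).2) (fun t ht => (hball t ht).1) ht
      (Metric.mem_ball_self hε)
  obtain ⟨t, ht, htw⟩ := ((eventually_nhdsWithin_of_eventually_nhds
    (Metric.ball_mem_nhds w hε)).and (self_mem_nhdsWithin (a := w) (s := {w}ᶜ))).exists
  exact htw (hinj (hball t ht).2 hw (hconst t ht))

theorem continuousAt_eval_relationPoint {p : ℂ → ℂ} {u : Fin 3 → ℂ}
    (hw : ContinuousAt p (u 0 * u 1 + u 2)) (hx : ∀ i, ContinuousAt p (u i))
    (E : MvPolynomial (Fin 4) ℂ) : ContinuousAt (fun v => eval (relationPoint p v) E) u := by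
  refine (MvPolynomial.continuous_eval E).continuousAt.comp (continuousAt_pi.2 fun i => ?_)
  have hc : ∀ i, ContinuousAt (fun v : Fin 3 → ℂ => v i) u := fun i =>
    (continuous_apply i).continuousAt
  fin_cases i
  · exact ContinuousAt.comp (f := fun v : Fin 3 → ℂ => v 0 * v 1 + v 2) hw
      (((hc 0).mul (hc 1)).add (hc 2))
  · exact ContinuousAt.comp (f := fun v : Fin 3 → ℂ => v 0) (hx 0) (hc 0)
  · exact ContinuousAt.comp (f := fun v : Fin 3 → ℂ => v 1) (hx 1) (hc 1)
  · exact ContinuousAt.comp (f := fun v : Fin 3 → ℂ => v 2) (hx 2) (hc 2)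

/-- Differentiating a polynomial relation among `p (x * y + z)`, `p x`, `p y`, `p z` in `x`. -/
theorem eval_pderiv_add_eq_zero_fst {p : ℂ → ℂ} {U : Set (Fin 3 → ℂ)} (hU : IsOpen U)
    {B : MvPolynomial (Fin 4) ℂ} (hB : ∀ u ∈ U, eval (relationPoint p u) B = 0) {x y z : ℂ}
    (hu : ![x, y, z] ∈ U) (hw : DifferentiableAt ℂ p (x * y + z)) (hx : DifferentiableAt ℂ p x) :
    eval ![p (x * y + z), p x, p y, p z] (pderiv 0 B) * (deriv p (x * y + z) * y) +
      eval ![p (x * y + z), p x, p y, p z] (pderiv 1 B) * deriv p x = 0 := by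
  have h := hasDerivAt_eval_comp B (c := fun s => ![p (s * y + z), p s, p y, p z])
    (c' := ![deriv p (x * y + z) * y, deriv p x, 0, 0]) (t := x) (by
      intro i
      fin_cases i
      · refine HasDerivAt.comp (h := fun s => s * y + z) x hw.hasDerivAt ?_
        simpa using ((hasDerivAt_id x).mul_const y).add_const z
      · exact hx.hasDerivAt
      all_goals exact hasDerivAt_const _ _)
  have hγ : Continuous fun s : ℂ => (![s, y, z] : Fin 3 → ℂ) := by
    refine continuous_pi fun i => ?_
    fin_cases i
    · exact continuous_id
    all_goals exact continuous_const
  have hev : (fun s => eval ![p (s * y + z), p s, p y, p z] B) =ᶠ[𝓝 x] fun _ => 0 := by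
    filter_upwards [hγ.continuousAt.eventually (hU.mem_nhds hu)] with s hs
    have := hB _ hs
    rwa [relationPoint_vec] at this
  have h0 := h.unique ((hasDerivAt_const _ _).congr_of_eventuallyEq hev)
  rw [Fin.sum_univ_four] at h0
  simpa using h0

/-- Differentiating a polynomial relation among `p (x * y + z)`, `p x`, `p y`, `p z` in `z`. -/
theorem eval_pderiv_add_eq_zero_thd {p : ℂ → ℂ} {U : Set (Fin 3 → ℂ)} (hU : IsOpen U)
    {B : MvPolynomial (Fin 4) ℂ} (hB : ∀ u ∈ U, eval (relationPoint p u) B = 0) {x y z : ℂ}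
    (hu : ![x, y, z] ∈ U) (hw : DifferentiableAt ℂ p (x * y + z)) (hz : DifferentiableAt ℂ p z) :
    eval ![p (x * y + z), p x, p y, p z] (pderiv 0 B) * deriv p (x * y + z) +
      eval ![p (x * y + z), p x, p y, p z] (pderiv 3 B) * deriv p z = 0 := by
  have h := hasDerivAt_eval_comp B (c := fun s => ![p (x * y + s), p x, p y, p s])
    (c' := ![deriv p (x * y + z), 0, 0, deriv p z]) (t := z) (by
      intro i
      fin_cases i
      · exact hw.hasDerivAt.comp_const_add (x * y) z
      · exact hasDerivAt_const _ _
      · exact hasDerivAt_const _ _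
      · exact hz.hasDerivAt)
  have hγ : Continuous fun s : ℂ => (![x, y, s] : Fin 3 → ℂ) := by
    refine continuous_pi fun i => ?_
    fin_cases i
    · exact continuous_const
    · exact continuous_const
    · exact continuous_id
  have hev : (fun s => eval ![p (x * y + s), p x, p y, p s] B) =ᶠ[𝓝 z] fun _ => 0 := by
    filter_upwards [hγ.continuousAt.eventually (hU.mem_nhds hu)] with s hs
    have := hB _ hs
    rwa [relationPoint_vec] at this
  have h0 := h.unique ((hasDerivAt_const _ _).congr_of_eventuallyEq hev)
  rw [Fin.sum_univ_four] at h0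
  simpa using h0

/-- A nonzero polynomial relation among `p (x * y + z)`, `p x`, `p y`, `p z` makes `p` algebraic near
some point: differentiating in `x` and in `z` expresses `y` as a rational function of
`p (x * y + z)` and `p y`. -/
theorem exists_eventually_algebraic {D : Set ℂ} (hD : IsOpen D) {p : ℂ → ℂ}
    (hp : DifferentiableOn ℂ p D) (hinj : Set.InjOn p D) {r : ℝ} (hr : 0 < r)
    (hUD : ∀ u ∈ Metric.ball (0 : Fin 3 → ℂ) r, u 0 * u 1 + u 2 ∈ D ∧ ∀ i, u i ∈ D)
    {A : MvPolynomial (Fin 4) ℂ} (hA0 : A ≠ 0)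
    (hA : ∀ u ∈ Metric.ball (0 : Fin 3 → ℂ) r, eval (relationPoint p u) A = 0) :
    ∃ y₀ ∈ D, ∃ f : MvPolynomial (Fin 2) ℂ, f ≠ 0 ∧ ∀ᶠ y in 𝓝 y₀, eval ![y, p y] f = 0 := by
  set U := Metric.ball (0 : Fin 3 → ℂ) r with hU
  have hUo : IsOpen U := Metric.isOpen_ball
  have hballD : Metric.ball 0 r ⊆ D := by
    intro x hx
    have h : (fun _ => x : Fin 3 → ℂ) ∈ U := by
      rw [mem_ball_zero_iff] at *
      exact (pi_norm_lt_iff hr).2 fun _ => hx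
    exact (hUD _ h).2 0
  obtain ⟨B, hB, hB'⟩ := exists_mem_pderiv_notMem (i := 0)
    (𝒥 := {B | ∀ u ∈ U, eval (relationPoint p u) B = 0})
    (fun B hB => eq_zero_of_eval_relationPoint_eq_zero hr (hinj.mono hballD) hB) hA hA0
  simp only [Set.mem_ofPred_eq, not_forall] at hB hB'
  have hpd : ∀ t ∈ D, DifferentiableAt ℂ p t := fun t ht => hp.differentiableAt (hD.mem_nhds ht)
  have hcont : ∀ (E : MvPolynomial (Fin 4) ℂ) (u : Fin 3 → ℂ), u ∈ U →
      ContinuousAt (fun v => eval (relationPoint p v) E) u := fun E u hu =>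
    continuousAt_eval_relationPoint (hpd _ (hUD u hu).1).continuousAt
      (fun i => (hpd _ ((hUD u hu).2 i)).continuousAt) E
  obtain ⟨x, y, z, hu, hne, hpne⟩ : ∃ x y z : ℂ, ![x, y, z] ∈ U ∧
      eval (relationPoint p ![x, y, z]) (pderiv 0 B) ≠ 0 ∧ deriv p (x * y + z) ≠ 0 := by
    obtain ⟨u, hu, hne⟩ := hB'
    let γ : ℂ → Fin 3 → ℂ := fun w => ![u 0, u 1, w - u 0 * u 1]
    have hγ0 : γ (u 0 * u 1 + u 2) = u := by
      ext i; fin_cases i <;> simp [γ]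
    have hγ : ContinuousAt γ (u 0 * u 1 + u 2) := by
      refine continuousAt_pi.2 fun i => ?_
      fin_cases i
      · exact continuousAt_const
      · exact continuousAt_const
      · exact continuousAt_id.sub continuousAt_const
    have h1 : ∀ᶠ w in 𝓝 (u 0 * u 1 + u 2), γ w ∈ U :=
      hγ.eventually (hUo.mem_nhds (by rwa [hγ0]))
    have h2 : ∀ᶠ w in 𝓝 (u 0 * u 1 + u 2), eval (relationPoint p (γ w)) (pderiv 0 B) ≠ 0 := by
      refine hγ.eventually (p := fun v => eval (relationPoint p v) (pderiv 0 B) ≠ 0) ?_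
      rw [hγ0]
      exact (hcont _ u hu).eventually_ne hne
    obtain ⟨w, h3, h4, h5⟩ := ((frequently_deriv_ne_zero_of_injOn hD hp hinj
      (hUD u hu).1).and_eventually (h1.and h2)).exists
    exact ⟨_, _, _, h4, h5, by rwa [add_sub_cancel]⟩
  obtain ⟨hw, hx⟩ := hUD _ hu
  have hxD : x ∈ D := hx 0
  have hyD : y ∈ D := hx 1
  have hzD : z ∈ D := hx 2
  have hγ : Continuous fun t : ℂ => (![x, t, z] : Fin 3 → ℂ) := by
    refine continuous_pi fun i => ?_
    fin_cases i
    · exact continuous_const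
    · exact continuous_id
    · exact continuous_const
  have hevU : ∀ᶠ t in 𝓝 y, ![x, t, z] ∈ U :=
    hγ.continuousAt.eventually (hUo.mem_nhds hu)
  have hdx := fun t (ht : ![x, t, z] ∈ U) =>
    eval_pderiv_add_eq_zero_fst hUo hB ht (hpd _ (hUD _ ht).1) (hpd _ hxD)
  have hdz := fun t (ht : ![x, t, z] ∈ U) =>
    eval_pderiv_add_eq_zero_thd hUo hB ht (hpd _ (hUD _ ht).1) (hpd _ hzD)
  let ρ : MvPolynomial (Fin 4) ℂ →ₐ[ℂ] MvPolynomial (Fin 2) ℂ :=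
    aeval ![X 0, C (p x), X 1, C (p z)]
  have hρ : ∀ (E : MvPolynomial (Fin 4) ℂ) (s t : ℂ),
      eval ![s, t] (ρ E) = eval ![s, p x, t, p z] E := by
    intro E s t
    have : (aeval ![s, t]).comp ρ = aeval ![s, p x, t, p z] := by
      ext i; fin_cases i <;> simp [ρ]
    exact DFunLike.congr_fun this E
  refine ⟨y, hyD, exists_eventually_eval_eq_zero (W := fun t => p (x * t + z)) (Y := p)
    (c := ρ B) (a := C (deriv p x) * ρ (pderiv 1 B)) (b := C (deriv p z) * ρ (pderiv 3 B))
    (hp.analyticAt (hD.mem_nhds hyD)) ?_ ?_ ?_ ?_⟩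
  · intro h0
    refine hne ?_
    rw [relationPoint_vec]
    have h := hasDerivAt_eval_comp B (c := fun t => ![t, p x, p y, p z]) (c' := ![1, 0, 0, 0])
      (t := p (x * y + z)) (by
        intro i
        fin_cases i
        · exact hasDerivAt_id _
        all_goals exact hasDerivAt_const _ _)
    have hz0 : (fun t => eval ![t, p x, p y, p z] B) = fun _ => 0 := by
      ext t; rw [← hρ, h0, map_zero]
    rw [hz0] at h
    simpa [Fin.sum_univ_four] using h.unique (hasDerivAt_const _ _)
  · filter_upwards [hevU] with t ht
    have h := hB _ ht
    rw [relationPoint_vec] at h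
    rw [hρ, h]
  · filter_upwards [hevU] with t ht
    have h1 := hdx t ht
    have h2 := hdz t ht
    simp only [map_mul, eval_C, hρ]
    linear_combination t * h2 - h1
  · have hc : ∀ᶠ t in 𝓝 y, eval (relationPoint p ![x, t, z]) (pderiv 3 B) * deriv p z ≠ 0 := by
      refine ContinuousAt.eventually_ne ?_ ?_
      · exact ((hcont _ _ hu).comp (f := fun t => ![x, t, z]) hγ.continuousAt).mul
          continuousAt_const
      · intro h0
        have := hdz y hu
        rw [← relationPoint_vec, h0, add_zero] at this
        exact mul_ne_zero hne hpne this
    filter_upwards [hc] with t ht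
    rw [relationPoint_vec] at ht
    rwa [map_mul, eval_C, hρ, mul_comm]

/-- If `p` is holomorphic and injective on an open set containing the closure of
the square `D`, and the relation `w = x·y + z` on `D` is carried by `p` to a
semialgebraic relation `T ⊆ ℂ⁴`, then `p` is algebraic on `D`: there is a nonzero
polynomial `f ∈ ℂ[z₁, z₂]` with `f(z, p(z)) = 0` for all `z ∈ D`. -/
theorem algebraicity_of_semialgebraic_holomorphic_map
    (a : ℝ) (ha : 0 < a) (p : ℂ → ℂ)
    (hp : ∃ V : Set ℂ, IsOpen V ∧ closure (squareDomain a) ⊆ V ∧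
      DifferentiableOn ℂ p V ∧ Set.InjOn p V)
    (T : Set (Fin 4 → ℂ))
    (hT : IsSemialgebraic (complexFourToRealEight '' T))
    (hTp : ∀ w x y z : ℂ, w ∈ squareDomain a → x ∈ squareDomain a →
      y ∈ squareDomain a → z ∈ squareDomain a →
      (w = x * y + z ↔ ![p w, p x, p y, p z] ∈ T)) :
    ∃ f : MvPolynomial (Fin 2) ℂ, f ≠ 0 ∧
      ∀ z ∈ squareDomain a, MvPolynomial.eval ![z, p z] f = 0 := by
  obtain ⟨V, -, hDV, hpV, hinjV⟩ := hp
  have hDV' := subset_closure.trans hDV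
  have hpD := hpV.mono hDV'
  have hD := isOpen_squareDomain a
  let r : ℝ := min 1 (a / 2)
  have hr : 0 < r := by positivity
  have hr1 : r ≤ 1 := min_le_left _ _
  have hra : r ≤ a / 2 := min_le_right _ _
  have hUD : ∀ u ∈ Metric.ball (0 : Fin 3 → ℂ) r,
      u 0 * u 1 + u 2 ∈ squareDomain a ∧ ∀ i, u i ∈ squareDomain a := by
    intro u hu
    have hui := (pi_norm_lt_iff hr).1 (mem_ball_zero_iff.1 hu)
    refine ⟨mem_squareDomain_of_norm_lt ?_, fun i =>
      mem_squareDomain_of_norm_lt ((hui i).trans_le (by linarith))⟩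
    calc ‖u 0 * u 1 + u 2‖ ≤ ‖u 0‖ * ‖u 1‖ + ‖u 2‖ := (norm_add_le _ _).trans (by rw [norm_mul])
      _ ≤ r * 1 + ‖u 2‖ := by
        gcongr
        · exact (hui 0).le
        · exact (hui 1).le.trans hr1
      _ < a := by linarith [hui 2]
  obtain ⟨A, hA0, hA⟩ := exists_eval_relationPoint_eq_zero hD hpD hT hTp Metric.isOpen_ball
    (convex_ball _ _) hUD
  obtain ⟨y₀, hy₀, f, hf0, hf⟩ :=
    exists_eventually_algebraic hD hpD (hinjV.mono hDV') hr hUD hA0 hA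
  refine ⟨f, hf0, fun z hz => ?_⟩
  have han : AnalyticOnNhd ℂ (fun z => eval ![z, p z] f) (squareDomain a) := by
    refine AnalyticOnNhd.aeval_mvPolynomial (f := fun z => ![z, p z]) (fun i => ?_) f
    fin_cases i
    · exact analyticOnNhd_id
    · exact hpD.analyticOnNhd hD
  exact han.eqOn_zero_of_preconnected_of_eventuallyEq_zero
    (convex_squareDomain a).isPreconnected hy₀ hf hz
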